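/- Fix rationals α, ξ with 0 < α < ξ ≤ 1/2, and set μ := (1 − √(1 − 4α(1−ξ)))/2. For each n such that l := αn and m := ξn are integers, let X_n be a random variable with probability mass function p_{n,m,l}. Then for every ε > 0 there exist c > 0 and N such that for all such n ≥ N, P(|X_n/n − μ| ≥ ε) ≤ e^{−cn}; i.e., the tail probability decays exponentially in n. -/

import Mathlib

/-- The Schur–Weyl measurement outcome distribution
`p_{n,m,l}(x) = (C(n,x)/C(n,m))·(C(l,x)/C(m,x))·((n−2x+1)/(n−x+1))·C(n−l−x, m−l)`
for `0 ≤ x ≤ l` (intended for `0 ≤ l ≤ m` and `2m ≤ n`). -/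
noncomputable def pSW (n m l x : ℕ) : ℝ :=
  ((n.choose x : ℝ) / (n.choose m)) * ((l.choose x : ℝ) / (m.choose x)) *
    (((n : ℝ) - 2 * x + 1) / ((n : ℝ) - x + 1)) *
    (((n - l - x).choose (m - l) : ℝ))

/-- For a rational ratio `θ`, the natural number `⌊θ n⌋`; on the set `exactSet`
below this equals `θ n` exactly. -/
def ratIdx (θ : ℚ) (n : ℕ) : ℕ := ⌊θ * n⌋₊

/-- The set of `n` for which both `α n` and `ξ n` are (natural) integers. -/
def exactSet (α ξ : ℚ) : Set ℕ :=
  {n : ℕ | ((ratIdx α n : ℚ) = α * n) ∧ ((ratIdx ξ n : ℚ) = ξ * n)}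

/-- The mass function `pSW` without the factor `(n - 2x + 1) / (n - x + 1)`. -/
noncomputable def swWeight (n m l x : ℕ) : ℝ :=
  ((n.choose x : ℝ) / (n.choose m)) * ((l.choose x : ℝ) / (m.choose x)) *
    (((n - l - x).choose (m - l) : ℝ))

theorem pSW_eq_swWeight_mul (n m l x : ℕ) :
    pSW n m l x = swWeight n m l x * (((n : ℝ) - 2 * x + 1) / ((n : ℝ) - x + 1)) := by
  unfold pSW swWeight; ring

theorem swWeight_nonneg (n m l x : ℕ) : 0 ≤ swWeight n m l x := by
  unfold swWeight; positivity

theorem swWeight_eq_zero {n m l x : ℕ} (h : l < x) : swWeight n m l x = 0 := by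
  simp [swWeight, Nat.choose_eq_zero_of_lt h]

theorem cast_choose_succ_right {n k : ℕ} (h : k ≤ n) :
    (n.choose (k + 1) : ℝ) * (k + 1) = n.choose k * (n - k) := by
  have := Nat.choose_succ_right_eq n k
  rw [← Nat.cast_sub h]
  exact_mod_cast this

theorem cast_succ_choose {n k : ℕ} (h : k ≤ n + 1) :
    (n.choose k : ℝ) * (n + 1) = (n + 1).choose k * (n + 1 - k) := by
  have := Nat.choose_mul_succ_eq n k
  have h2 : ((n + 1 - k : ℕ) : ℝ) = n + 1 - k := by rw [Nat.cast_sub h]; push_cast; ring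
  rw [← h2]
  exact_mod_cast this

theorem cast_succ_choose_succ (n k : ℕ) :
    ((n : ℝ) + 1) * n.choose k = (n + 1).choose (k + 1) * (k + 1) := by
  exact_mod_cast Nat.add_one_mul_choose_eq n k

theorem swWeight_succ_right {n m l x : ℕ} (hx : x ≤ l) (hl : l < m) (hm : 2 * m ≤ n) :
    ((x : ℝ) + 1) * (m - x) * (n - l - x) * swWeight n m l (x + 1) =
      (n - x) * (l - x) * (n - m - x) * swWeight n m l x := by
  obtain ⟨k, rfl⟩ : ∃ k, m = l + k := ⟨m - l, by omega⟩
  obtain ⟨N, rfl⟩ : ∃ N, n = l + x + N + 1 := ⟨n - l - x - 1, by omega⟩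
  have e1 : l + x + N + 1 - l - x = N + 1 := by omega
  have e2 : l + x + N + 1 - l - (x + 1) = N := by omega
  have e3 : l + k - l = k := by omega
  unfold swWeight
  rw [e1, e2, e3]
  have a1 := cast_choose_succ_right (n := l + x + N + 1) (k := x) (by omega)
  have a2 := cast_choose_succ_right (n := l) (k := x) hx
  have a3 := cast_choose_succ_right (n := l + k) (k := x) (by omega)
  have a4 := cast_succ_choose (n := N) (k := k) (by omega)
  have p1 : (0 : ℝ) < (l + k).choose x := by exact_mod_cast Nat.choose_pos (by omega)
  have p2 : (0 : ℝ) < (l + k).choose (x + 1) := by exact_mod_cast Nat.choose_pos (by omega)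
  have p3 : (0 : ℝ) < (l + x + N + 1).choose (l + k) := by
    exact_mod_cast Nat.choose_pos (by omega)
  have hx1 : (0 : ℝ) < x + 1 := by positivity
  rw [← eq_div_iff hx1.ne'] at a1 a2
  have hmx : (0 : ℝ) < ((l + k : ℕ) : ℝ) - x := by
    rw [sub_pos]; exact_mod_cast (by omega : x < l + k)
  rw [← eq_div_iff hx1.ne'] at a3
  have hN : (0 : ℝ) < (N : ℝ) + 1 := by positivity
  rw [← eq_div_iff hN.ne'] at a4
  rw [a1, a2, a3, a4]
  push_cast at *
  field_simp
  ring

theorem swWeight_succ_succ {n m l x : ℕ} (hx : x ≤ l) (hl : l < m) (hm : 2 * m ≤ n) :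
    ((x : ℝ) + 1) * (m - x) * (n - l - x) * (n - l - x - 1) * swWeight n m (l + 1) (x + 1) =
      (n - x) * (l + 1) * (m - l) * (n - m - x) * swWeight n m l x := by
  obtain ⟨k, rfl⟩ : ∃ k, m = l + k + 1 := ⟨m - l - 1, by omega⟩
  obtain ⟨N, rfl⟩ : ∃ N, n = l + x + N + 2 := ⟨n - l - x - 2, by omega⟩
  have e1 : l + x + N + 2 - l - x = N + 1 + 1 := by omega
  have e2 : l + x + N + 2 - (l + 1) - (x + 1) = N := by omega
  have e3 : l + k + 1 - l = k + 1 := by omega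
  have e4 : l + k + 1 - (l + 1) = k := by omega
  unfold swWeight
  rw [e1, e2, e3, e4]
  have a1 := cast_choose_succ_right (n := l + x + N + 2) (k := x) (by omega)
  have a2 := cast_succ_choose_succ l x
  have a3 := cast_choose_succ_right (n := l + k + 1) (k := x) (by omega)
  have a4 := cast_succ_choose (n := N) (k := k) (by omega)
  have a5 := cast_succ_choose_succ (N + 1) k
  have p1 : (0 : ℝ) < (l + k + 1).choose x := by exact_mod_cast Nat.choose_pos (by omega)
  have p3 : (0 : ℝ) < (l + x + N + 2).choose (l + k + 1) := by
    exact_mod_cast Nat.choose_pos (by omega)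
  have hx1 : (0 : ℝ) < x + 1 := by positivity
  have hmx : (0 : ℝ) < ((l + k + 1 : ℕ) : ℝ) - x := by
    rw [sub_pos]; exact_mod_cast (by omega : x < l + k + 1)
  have hN : (0 : ℝ) < (N : ℝ) + 1 := by positivity
  have hN2 : (0 : ℝ) < ((N + 1 : ℕ) : ℝ) + 1 := by positivity
  have hk : (0 : ℝ) < (k : ℝ) + 1 := by positivity
  rw [← eq_div_iff hx1.ne'] at a1 a3
  rw [eq_comm, ← eq_div_iff hx1.ne'] at a2
  rw [← eq_div_iff hN.ne'] at a4
  rw [eq_comm, ← eq_div_iff hk.ne'] at a5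
  rw [a1, a2, a3, a4, a5]
  push_cast at *
  field_simp
  ring

theorem swWeight_succ_zero {n m l : ℕ} (hl : l < m) (hm : 2 * m ≤ n) :
    ((n : ℝ) - l) * swWeight n m (l + 1) 0 = (m - l) * swWeight n m l 0 := by
  obtain ⟨k, rfl⟩ : ∃ k, m = l + k + 1 := ⟨m - l - 1, by omega⟩
  obtain ⟨N, rfl⟩ : ∃ N, n = l + N + 1 := ⟨n - l - 1, by omega⟩
  have e1 : l + N + 1 - l - 0 = N + 1 := by omega
  have e2 : l + N + 1 - (l + 1) - 0 = N := by omega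
  have e3 : l + k + 1 - l = k + 1 := by omega
  have e4 : l + k + 1 - (l + 1) = k := by omega
  unfold swWeight
  rw [e1, e2, e3, e4]
  have a5 := cast_succ_choose_succ N k
  simp only [Nat.choose_zero_right]
  push_cast
  linear_combination (1 / ((l + N + 1).choose (l + k + 1) : ℝ)) * a5

/-- Passing from `l` to `l + 1` is a step of a Markov chain which moves from `x` to `x + 1` with
probability `(n - m - x) (n - x + 1) / ((n - l - x) (n - 2x + 1))`. -/
theorem sum_pSW_succ_partial {n m l : ℕ} (hl : l < m) (hm : 2 * m ≤ n) (j : ℕ) (hj : j ≤ l) :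
    ∑ x ∈ Finset.range (j + 1), pSW n m (l + 1) x =
      ∑ x ∈ Finset.range (j + 1), pSW n m l x -
        swWeight n m l j * (((n : ℝ) - m - j) / (n - l - j)) := by
  have hm' : 2 * (m : ℝ) ≤ n := by exact_mod_cast hm
  have hl' : (l : ℝ) + 1 ≤ m := by exact_mod_cast hl
  induction j with
  | zero =>
    simp only [zero_add, Finset.range_one, Finset.sum_singleton, pSW_eq_swWeight_mul]
    have h := swWeight_succ_zero hl hm
    have hp : (0 : ℝ) < n - l := by
      have : (0 : ℝ) ≤ l := by positivity
      linarith
    rw [mul_comm, ← eq_div_iff hp.ne'] at h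
    rw [h]
    have : (n : ℝ) + 1 ≠ 0 := by positivity
    push_cast
    simp only [mul_zero, sub_zero]
    field_simp
    ring
  | succ j ih =>
    rw [Finset.sum_range_succ, Finset.sum_range_succ _ (j + 1), ih (by omega)]
    have h1 := swWeight_succ_right (n := n) (by omega : j ≤ l) hl hm
    have h2 := swWeight_succ_succ (n := n) (by omega : j ≤ l) hl hm
    have hj' : (j : ℝ) + 1 ≤ l := by exact_mod_cast hj
    have hj0 : (0 : ℝ) ≤ j := by positivity
    have q1 : (0 : ℝ) < j + 1 := by positivity
    have q2 : (0 : ℝ) < m - j := by linarith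
    have q3 : (0 : ℝ) < n - l - j := by linarith
    have q4 : (0 : ℝ) < n - l - j - 1 := by linarith
    have q5 : (0 : ℝ) < n - j := by linarith
    have q6 : (0 : ℝ) < n - 2 * j - 1 := by linarith
    rw [mul_comm, ← eq_div_iff (by positivity)] at h1 h2
    rw [pSW_eq_swWeight_mul, pSW_eq_swWeight_mul, h1, h2]
    push_cast
    have c1 : (n : ℝ) - (j + 1) + 1 = n - j := by ring
    have c2 : (n : ℝ) - l - (j + 1) = n - l - j - 1 := by ring
    rw [c1, c2]
    field_simp
    ring

theorem sum_pSW_eq_one {n m l : ℕ} (hl : l ≤ m) (hm : 2 * m ≤ n) :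
    ∑ x ∈ Finset.range (l + 1), pSW n m l x = 1 := by
  induction l with
  | zero =>
    have p : ((n.choose m : ℕ) : ℝ) ≠ 0 := by
      exact_mod_cast (Nat.choose_pos (by omega)).ne'
    have : (n : ℝ) + 1 ≠ 0 := by positivity
    simp [pSW, p, this]
  | succ l ih =>
    rw [Finset.sum_range_succ, sum_pSW_succ_partial hl hm l le_rfl, ih (by omega),
      pSW_eq_swWeight_mul]
    have hm' : 2 * (m : ℝ) ≤ n := by exact_mod_cast hm
    have hl' : (l : ℝ) + 1 ≤ m := by exact_mod_cast hl
    have h2 := swWeight_succ_succ (n := n) (le_refl l) hl hm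
    have hj0 : (0 : ℝ) ≤ l := by positivity
    have q1 : (0 : ℝ) < l + 1 := by positivity
    have q2 : (0 : ℝ) < m - l := by linarith
    have q3 : (0 : ℝ) < n - l - l := by linarith
    have q4 : (0 : ℝ) < n - l - l - 1 := by linarith
    have q5 : (0 : ℝ) < n - l := by linarith
    rw [mul_comm, ← eq_div_iff (by positivity)] at h2
    rw [h2]
    push_cast
    have c1 : (n : ℝ) - (l + 1) + 1 = n - l := by ring
    rw [c1]
    field_simp
    ring

theorem pSW_nonneg {n m l x : ℕ} (hx : 2 * x ≤ n) : 0 ≤ pSW n m l x := by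
  rw [pSW_eq_swWeight_mul]
  have h : 2 * (x : ℝ) ≤ n := by exact_mod_cast hx
  have h0 : (0 : ℝ) ≤ x := by positivity
  exact mul_nonneg (swWeight_nonneg ..) (div_nonneg (by linarith) (by linarith))

theorem pSW_le_one {n m l x : ℕ} (hx : x ≤ l) (hl : l ≤ m) (hm : 2 * m ≤ n) :
    pSW n m l x ≤ 1 := by
  rw [← sum_pSW_eq_one hl hm]
  refine Finset.single_le_sum (f := pSW n m l) (fun i hi => pSW_nonneg ?_) (by simp; omega)
  simp at hi
  omega

theorem pSW_le_swWeight {n m l x : ℕ} (hx : 2 * x ≤ n) : pSW n m l x ≤ swWeight n m l x := by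
  rw [pSW_eq_swWeight_mul]
  have h : 2 * (x : ℝ) ≤ n := by exact_mod_cast hx
  have h0 : (0 : ℝ) ≤ x := by positivity
  refine mul_le_of_le_one_right (swWeight_nonneg ..) ?_
  rw [div_le_one (by linarith)]
  linarith

/-- If `l ≤ a n` with `a < 1 / 2`, the weights are bounded uniformly in `n`. -/
theorem swWeight_le {n m l x : ℕ} {a : ℝ} (ha : a < 1 / 2) (ha0 : 0 < a) (hla : (l : ℝ) ≤ a * n)
    (hl : l ≤ m) (hm : 2 * m ≤ n) : swWeight n m l x ≤ (1 - 2 * a)⁻¹ := by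
  have hK : 0 < 1 - 2 * a := by linarith
  rcases lt_or_ge l x with h | h
  · rw [swWeight_eq_zero h]; positivity
  · have h1 := pSW_le_one h hl hm
    rw [pSW_eq_swWeight_mul] at h1
    have hx : (x : ℝ) ≤ l := by exact_mod_cast h
    have hx0 : (0 : ℝ) ≤ x := by positivity
    have hn0 : (0 : ℝ) ≤ n := by positivity
    have hlow : 1 - 2 * a ≤ ((n : ℝ) - 2 * x + 1) / ((n : ℝ) - x + 1) := by
      rw [le_div_iff₀ (by nlinarith)]
      nlinarith
    rw [← one_div, le_div_iff₀ hK]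
    exact (mul_le_mul_of_nonneg_left hlow (swWeight_nonneg ..)).trans h1

theorem geometric_increase {f : ℕ → ℝ} {r : ℝ} (hr : 0 ≤ r) (x k : ℕ)
    (h : ∀ i < k, r * f (x + i) ≤ f (x + i + 1)) : r ^ k * f x ≤ f (x + k) := by
  induction k with
  | zero => simp
  | succ k ih =>
    calc r ^ (k + 1) * f x = r * (r ^ k * f x) := by ring
      _ ≤ r * f (x + k) := mul_le_mul_of_nonneg_left (ih fun i hi => h i (by omega)) hr
      _ ≤ f (x + (k + 1)) := h k (by omega)

theorem geometric_decrease {f : ℕ → ℝ} {r : ℝ} (hr : 0 ≤ r) (x k : ℕ)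
    (h : ∀ i < k, r * f (x + i + 1) ≤ f (x + i)) : r ^ k * f (x + k) ≤ f x := by
  induction k with
  | zero => simp
  | succ k ih =>
    calc r ^ (k + 1) * f (x + (k + 1)) = r ^ k * (r * f (x + k + 1)) := by ring_nf
      _ ≤ r ^ k * f (x + k) := mul_le_mul_of_nonneg_left (h k (by omega)) (by positivity)
      _ ≤ f x := ih fun i hi => h i (by omega)

/-- The difference of the two coefficients in `swWeight_succ_right`, factored using a root `μ` of
`y ^ 2 - y + α (1 - ξ)`. -/
theorem swWeight_coeff_sub {n x a ξ μ : ℝ} (hμ : μ ^ 2 - μ + a * (1 - ξ) = 0) :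
    (n - x) * (a * n - x) * (n - ξ * n - x) - (x + 1) * (ξ * n - x) * (n - a * n - x) =
      (n - 2 * x) * (μ * n - x) * ((1 - μ) * n - x) - (ξ * n - x) * (n - a * n - x) := by
  linear_combination (n - 2 * x) * n ^ 2 * hμ

section Tail

variable {n m l x : ℕ} {a ξ μ ε : ℝ}

theorem swWeight_increase (hla : (l : ℝ) = a * n) (hmξ : (m : ℝ) = ξ * n) (ha0 : 0 < a)
    (haξ : a < ξ) (hξ : ξ ≤ 1 / 2) (hμ : μ ^ 2 - μ + a * (1 - ξ) = 0) (hμh : μ ≤ 1 / 2)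
    (hμa : μ ≤ a) (hε : 0 < ε) (hn : (1 : ℝ) ≤ n) (hnε : 4 ≤ (1 - 2 * a) ^ 2 * ε * n)
    (hx : (x : ℝ) ≤ (μ - ε) * n) :
    (1 + (1 - 2 * a) ^ 2 * ε / 8) * swWeight n m l x ≤ swWeight n m l (x + 1) := by
  have hx0 : (0 : ℝ) ≤ x := by positivity
  have hxl' : (x : ℝ) ≤ l := by rw [hla]; nlinarith
  have hxl : x ≤ l := by exact_mod_cast hxl'
  have hlm' : (l : ℝ) < m := by rw [hla, hmξ]; nlinarith
  have hlm : l < m := by exact_mod_cast hlm'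
  have hmn' : 2 * (m : ℝ) ≤ n := by rw [hmξ]; nlinarith
  have hmn : 2 * m ≤ n := by exact_mod_cast hmn'
  have hrec := swWeight_succ_right hxl hlm hmn
  have hsub := swWeight_coeff_sub (n := (n : ℝ)) (x := x) hμ
  rw [← hla, ← hmξ] at hsub
  have ha : 0 < 1 - 2 * a := by linarith
  have b1 : (1 - 2 * a) * n ≤ n - 2 * x := by linarith
  have b2 : ε * n ≤ μ * n - x := by linarith
  have b3 : (1 - 2 * a) / 2 * n ≤ (1 - μ) * n - x := by nlinarith
  have hmain : (1 - 2 * a) * n * (ε * n) * ((1 - 2 * a) / 2 * n) ≤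
      (n - 2 * x) * (μ * n - x) * ((1 - μ) * n - x) := by
    have c1 : 0 ≤ (1 - 2 * a) * n := by positivity
    have c2 : 0 ≤ ε * n := by positivity
    exact mul_le_mul (mul_le_mul b1 b2 c2 (c1.trans b1)) b3 (by positivity)
      (mul_nonneg (c1.trans b1) (c2.trans b2))
  have hsmall : ((m : ℝ) - x) * (n - l - x) ≤ n * n :=
    mul_le_mul (by linarith) (by linarith) (by linarith) (by linarith)
  have hD : ((x : ℝ) + 1) * (m - x) * (n - l - x) ≤ 2 * n * n * n :=
    mul_le_mul (mul_le_mul (by linarith) (by linarith) (by linarith) (by linarith))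
      (by linarith) (by linarith) (by positivity)
  have hDpos : 0 < ((x : ℝ) + 1) * (m - x) * (n - l - x) :=
    mul_pos (mul_pos (by linarith) (by linarith)) (by linarith)
  set δ := (1 - 2 * a) ^ 2 * ε / 8 with hδ
  have hδ0 : 0 < δ := by positivity
  have hsq : (n : ℝ) * n * 4 ≤ n * n * (8 * δ * n) :=
    mul_le_mul_of_nonneg_left (by rw [hδ]; linarith) (by positivity)
  have hcoef : (1 + δ) * (((x : ℝ) + 1) * (m - x) * (n - l - x)) ≤
      (n - x) * (l - x) * (n - m - x) := by
    have h1 := mul_le_mul_of_nonneg_left hD hδ0.le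
    have h2 : (1 - 2 * a) * n * (ε * n) * ((1 - 2 * a) / 2 * n) = 4 * δ * (n * n * n) := by
      rw [hδ]; ring
    linarith
  refine le_of_mul_le_mul_left ?_ hDpos
  rw [hrec, ← mul_assoc, mul_comm _ (1 + δ)]
  exact mul_le_mul_of_nonneg_right hcoef (swWeight_nonneg ..)

theorem swWeight_decrease (hla : (l : ℝ) = a * n) (hmξ : (m : ℝ) = ξ * n) (ha0 : 0 < a)
    (haξ : a < ξ) (hξ : ξ ≤ 1 / 2) (hμ : μ ^ 2 - μ + a * (1 - ξ) = 0) (hμh : μ ≤ 1 / 2)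
    (hε : 0 < ε) (hn : (1 : ℝ) ≤ n) (hx : (μ + ε) * n ≤ x) :
    (1 + (1 - 2 * a) ^ 2 * ε / 8) * swWeight n m l (x + 1) ≤ swWeight n m l x := by
  rcases lt_or_ge l (x + 1) with hxl1 | hxl1
  · rw [swWeight_eq_zero hxl1, mul_zero]
    exact swWeight_nonneg ..
  have hx0 : (0 : ℝ) ≤ x := by positivity
  have hxl : x ≤ l := by omega
  have hxl' : (x : ℝ) ≤ l := by exact_mod_cast hxl
  have hlm' : (l : ℝ) < m := by rw [hla, hmξ]; nlinarith
  have hlm : l < m := by exact_mod_cast hlm'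
  have hmn' : 2 * (m : ℝ) ≤ n := by rw [hmξ]; nlinarith
  have hmn : 2 * m ≤ n := by exact_mod_cast hmn'
  have hrec := swWeight_succ_right hxl hlm hmn
  have hsub := swWeight_coeff_sub (n := (n : ℝ)) (x := x) hμ
  rw [← hla, ← hmξ] at hsub
  have ha : 0 < 1 - 2 * a := by linarith
  have b1 : (1 - 2 * a) * n ≤ n - 2 * x := by linarith
  have b2 : ε * n ≤ x - μ * n := by linarith
  have b3 : (1 - 2 * a) / 2 * n ≤ (1 - μ) * n - x := by nlinarith
  have hmain : (1 - 2 * a) * n * (ε * n) * ((1 - 2 * a) / 2 * n) ≤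
      (n - 2 * x) * (x - μ * n) * ((1 - μ) * n - x) := by
    have c1 : 0 ≤ (1 - 2 * a) * n := by positivity
    have c2 : 0 ≤ ε * n := by positivity
    exact mul_le_mul (mul_le_mul b1 b2 c2 (c1.trans b1)) b3 (by positivity)
      (mul_nonneg (c1.trans b1) (c2.trans b2))
  have hsmall : 0 ≤ ((m : ℝ) - x) * (n - l - x) := mul_nonneg (by linarith) (by linarith)
  have hN : ((n : ℝ) - x) * (l - x) * (n - m - x) ≤ n * n * n :=
    mul_le_mul (mul_le_mul (by linarith) (by linarith) (by linarith) (by linarith))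
      (by linarith) (by linarith) (by positivity)
  have hDpos : 0 < ((x : ℝ) + 1) * (m - x) * (n - l - x) :=
    mul_pos (mul_pos (by linarith) (by linarith)) (by linarith)
  set δ := (1 - 2 * a) ^ 2 * ε / 8 with hδ
  have hδ0 : 0 < δ := by positivity
  have hcoef : (1 + δ) * (((n : ℝ) - x) * (l - x) * (n - m - x)) ≤
      (x + 1) * (m - x) * (n - l - x) := by
    have h1 := mul_le_mul_of_nonneg_left hN hδ0.le
    have h2 : (1 - 2 * a) * n * (ε * n) * ((1 - 2 * a) / 2 * n) = 4 * δ * (n * n * n) := by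
      rw [hδ]; ring
    have h3 : 0 ≤ δ * ((n : ℝ) * n * n) := by positivity
    linarith
  refine le_of_mul_le_mul_left ?_ hDpos
  rw [mul_left_comm, hrec, ← mul_assoc]
  exact mul_le_mul_of_nonneg_right hcoef (swWeight_nonneg ..)

/-- Away from `μ n` the weights are exponentially small. -/
theorem pow_mul_swWeight_le (hla : (l : ℝ) = a * n) (hmξ : (m : ℝ) = ξ * n) (ha0 : 0 < a)
    (haξ : a < ξ) (hξ : ξ ≤ 1 / 2) (hμ : μ ^ 2 - μ + a * (1 - ξ) = 0) (hμ0 : 0 ≤ μ)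
    (hμh : μ ≤ 1 / 2) (hμa : μ ≤ a) (hε : 0 < ε) (hn : (1 : ℝ) ≤ n)
    (hnε : 4 ≤ (1 - 2 * a) ^ 2 * (ε / 2) * n) (hx : ε ≤ |(x : ℝ) / n - μ|) :
    (1 + (1 - 2 * a) ^ 2 * (ε / 2) / 8) ^ ⌊ε / 2 * n⌋₊ * swWeight n m l x ≤
      (1 - 2 * a)⁻¹ := by
  have hlm' : (l : ℝ) ≤ m := by rw [hla, hmξ]; nlinarith
  have hlm : l ≤ m := by exact_mod_cast hlm'
  have hmn' : 2 * (m : ℝ) ≤ n := by rw [hmξ]; nlinarith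
  have hmn : 2 * m ≤ n := by exact_mod_cast hmn'
  have hn0 : (0 : ℝ) < n := by linarith
  have hbound (y : ℕ) : swWeight n m l y ≤ (1 - 2 * a)⁻¹ :=
    swWeight_le (by linarith) ha0 hla.le hlm hmn
  have hr : 0 ≤ 1 + (1 - 2 * a) ^ 2 * (ε / 2) / 8 := by positivity
  have hk : (⌊ε / 2 * n⌋₊ : ℝ) ≤ ε / 2 * n := Nat.floor_le (by positivity)
  set k := ⌊ε / 2 * n⌋₊
  rcases le_abs.mp hx with h | h
  · rw [le_sub_iff_add_le, le_div_iff₀ hn0] at h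
    have hkx' : (k : ℝ) ≤ x := by nlinarith
    obtain ⟨y, rfl⟩ : ∃ y, x = y + k := ⟨x - k, by
      have : k ≤ x := by exact_mod_cast hkx'
      omega⟩
    push_cast at h
    refine (geometric_decrease hr y k fun i hi => ?_).trans (hbound y)
    refine swWeight_decrease hla hmξ ha0 haξ hξ hμ hμh (half_pos hε) hn ?_
    push_cast
    have : (0 : ℝ) ≤ i := by positivity
    linarith
  · have h' : (x : ℝ) / n ≤ μ - ε := by linarith
    rw [div_le_iff₀ hn0] at h'
    refine (geometric_increase hr x k fun i hi => ?_).trans (hbound (x + k))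
    refine swWeight_increase hla hmξ ha0 haξ hξ hμ hμh hμa (half_pos hε) hn hnε ?_
    push_cast
    have : (i : ℝ) ≤ k := by exact_mod_cast hi.le
    linarith

end Tail

theorem exp_mul_le_pow_floor {r t : ℝ} (hr : 1 ≤ r) :
    Real.exp ((t - 1) * Real.log r) ≤ r ^ ⌊t⌋₊ := by
  have h : Real.exp (⌊t⌋₊ * Real.log r) = r ^ ⌊t⌋₊ := by
    rw [Real.exp_nat_mul, Real.exp_log (by linarith)]
  rw [← h, Real.exp_le_exp]
  exact mul_le_mul_of_nonneg_right (Nat.sub_one_lt_floor t).le (Real.log_nonneg hr)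

theorem mul_le_exp_of_le {b C t : ℝ} (hb : 0 < b) (hC : 0 < C) (ht : 1 ≤ t)
    (h : 4 * C / b ^ 2 ≤ t) : (t + 1) * C ≤ Real.exp (b * t) := by
  have h1 := Real.quadratic_le_exp_of_nonneg (x := b * t) (by positivity)
  rw [div_le_iff₀ (by positivity)] at h
  have h2 : 0 ≤ b * t := by positivity
  nlinarith

/-- exponential decay of the tail probability: for every `ε > 0`
there are `c > 0` and `N` so that `P(|X_n/n − μ| ≥ ε) ≤ e^{−cn}` for all
`n ≥ N` for which `αn` and `ξn` are integers. -/
theorem statement_15 (α ξ : ℚ) (h0 : 0 < α) (h1 : α < ξ) (h2 : ξ ≤ 1 / 2)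
    (μ : ℝ) (hμ : μ = (1 - Real.sqrt (1 - 4 * (α : ℝ) * (1 - (ξ : ℝ)))) / 2) :
    ∀ ε : ℝ, 0 < ε → ∃ c : ℝ, 0 < c ∧ ∃ N : ℕ, ∀ n : ℕ, N ≤ n → n ∈ exactSet α ξ →
      (∑ x ∈ Finset.range (ratIdx α n + 1),
          if ε ≤ |(x : ℝ) / n - μ| then pSW n (ratIdx ξ n) (ratIdx α n) x else 0)
        ≤ Real.exp (-c * n) := by
  intro ε hε
  set a : ℝ := (α : ℝ) with ha
  set z : ℝ := (ξ : ℝ) with hz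
  have ha0 : 0 < a := by rw [ha]; exact_mod_cast h0
  have haz : a < z := by rw [ha, hz]; exact_mod_cast h1
  have hz2 : z ≤ 1 / 2 := by
    have : ((ξ : ℚ) : ℝ) ≤ ((1 / 2 : ℚ) : ℝ) := by exact_mod_cast h2
    rw [hz]; simpa using this
  have hdisc : 0 ≤ 1 - 4 * a * (1 - z) := by nlinarith [sq_nonneg (1 - 2 * z)]
  have hsq := Real.sq_sqrt hdisc
  have hs0 := Real.sqrt_nonneg (1 - 4 * a * (1 - z))
  set s := Real.sqrt (1 - 4 * a * (1 - z))
  have hroot : μ ^ 2 - μ + a * (1 - z) = 0 := by rw [hμ]; linear_combination hsq / 4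
  have hμh : μ ≤ 1 / 2 := by linarith
  have hμ0 : 0 ≤ μ := by
    have : s ≤ 1 := by
      apply Real.sqrt_le_one.mpr
      nlinarith
    linarith
  have hμa : μ ≤ a := by nlinarith
  set δ := (1 - 2 * a) ^ 2 * (ε / 2) / 8 with hδ
  have hδ0 : 0 < δ := by
    have : 0 < 1 - 2 * a := by linarith
    positivity
  set L := Real.log (1 + δ) with hL
  have hL0 : 0 < L := Real.log_pos (by linarith)
  set K := (1 - 2 * a)⁻¹ with hK
  have hK0 : 0 < K := inv_pos.mpr (by linarith)
  have hb : 0 < ε / 4 * L := by positivity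
  refine ⟨ε / 4 * L, hb,
    ⌈max 1 (max (1 / (2 * δ)) (4 * (K * Real.exp L) / (ε / 4 * L) ^ 2))⌉₊,
    fun n hn hnS => ?_⟩
  obtain ⟨hα, hξ⟩ := hnS
  have hla : ((ratIdx α n : ℕ) : ℝ) = a * n := by rw [ha]; exact_mod_cast hα
  have hmz : ((ratIdx ξ n : ℕ) : ℝ) = z * n := by rw [hz]; exact_mod_cast hξ
  generalize ratIdx α n = l at *
  generalize ratIdx ξ n = m at *
  have hn' := Nat.ceil_le.mp hn
  rw [max_le_iff, max_le_iff] at hn'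
  obtain ⟨n1, n2, n3⟩ := hn'
  rw [div_le_iff₀ (by positivity)] at n2
  have hln : 2 * l ≤ n := by
    have : 2 * (l : ℝ) ≤ n := by rw [hla]; nlinarith
    exact_mod_cast this
  have hterm (x : ℕ) (hx : x ∈ Finset.range (l + 1)) :
      (if ε ≤ |(x : ℝ) / n - μ| then pSW n m l x else 0) ≤
        K * Real.exp (-((ε / 2 * n - 1) * L)) := by
    split_ifs with hdev
    · rw [Finset.mem_range] at hx
      have h3 := pow_mul_swWeight_le hla hmz ha0 haz hz2 hroot hμ0 hμh hμa hε n1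
        (by rw [hδ] at n2; linarith) hdev
      have h4 := mul_le_mul_of_nonneg_right
        (exp_mul_le_pow_floor (r := 1 + δ) (t := ε / 2 * n) (by linarith))
        (swWeight_nonneg n m l x)
      refine (pSW_le_swWeight (by omega)).trans ?_
      rw [Real.exp_neg, ← div_eq_mul_inv, le_div_iff₀ (Real.exp_pos _), mul_comm]
      exact h4.trans h3
    · positivity
  have hle : (l : ℝ) ≤ n := by exact_mod_cast (by omega : l ≤ n)
  calc (∑ x ∈ Finset.range (l + 1), if ε ≤ |(x : ℝ) / n - μ| then pSW n m l x else 0)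
      ≤ (l + 1) * (K * Real.exp (-((ε / 2 * n - 1) * L))) := by
        refine (Finset.sum_le_sum hterm).trans_eq ?_
        simp
    _ ≤ (n + 1) * (K * Real.exp (-((ε / 2 * n - 1) * L))) := by gcongr
    _ = (n + 1) * (K * Real.exp L) * Real.exp (-(ε / 2 * L * n)) := by
        rw [show -((ε / 2 * n - 1) * L) = L + -(ε / 2 * L * n) by ring, Real.exp_add]
        ring
    _ ≤ Real.exp (ε / 4 * L * n) * Real.exp (-(ε / 2 * L * n)) := by
        gcongr
        exact mul_le_exp_of_le hb (by positivity) n1 n3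
    _ = Real.exp (-(ε / 4 * L) * n) := by
        rw [← Real.exp_add]
        ring_nf
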